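/- arXiv:2103.09111 — 2 statements merged into one kernel-verified Lean document; each statement's English description precedes it below -/
import Mathlib

section
/- Let v > 0, a > 0, and ω ≠ 0 be real numbers, and set X = ∫₀^{v/a} (v − a t)·cos(ω t) dt and Y = ∫₀^{v/a} (v − a t)·sin(ω t) dt. Then X² + Y² = g(v, ω, a)/ω⁴, where g(v, ω, a) = v²ω² + 2a²·(1 − cos(vω/a)) − 2 v ω a·sin(vω/a). Consequently the displacement of the robot at the braking time, √(X² + Y²), equals √(g(v, ω, a))/ω². -/
theorem integral_affine_mul_cos (v a ω T : ℝ) (hω : ω ≠ 0) :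
    ∫ t in (0 : ℝ)..T, (v - a * t) * Real.cos (ω * t) =
      (v - a * T) * Real.sin (ω * T) / ω + a * (1 - Real.cos (ω * T)) / ω ^ 2 := by
  have h (t : ℝ) : HasDerivAt
      (fun t ↦ (v - a * t) * Real.sin (ω * t) / ω - a * Real.cos (ω * t) / ω ^ 2)
      ((v - a * t) * Real.cos (ω * t)) t := by
    have hlin : HasDerivAt (fun t ↦ ω * t) ω t := by simpa using (hasDerivAt_id t).const_mul ω
    have haff : HasDerivAt (fun t ↦ v - a * t) (-a) t := by
      simpa using ((hasDerivAt_id t).const_mul a).const_sub v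
    refine (((haff.mul hlin.sin).div_const ω).sub
      ((hlin.cos.const_mul a).div_const (ω ^ 2))).congr_deriv ?_
    field_simp
    ring
  rw [intervalIntegral.integral_eq_sub_of_hasDerivAt (fun t _ ↦ h t)
    (Continuous.intervalIntegrable (by fun_prop) _ _)]
  simp only [mul_zero, Real.sin_zero, Real.cos_zero]
  ring

theorem integral_affine_mul_sin (v a ω T : ℝ) (hω : ω ≠ 0) :
    ∫ t in (0 : ℝ)..T, (v - a * t) * Real.sin (ω * t) =
      (v - (v - a * T) * Real.cos (ω * T)) / ω - a * Real.sin (ω * T) / ω ^ 2 := by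
  have h (t : ℝ) : HasDerivAt
      (fun t ↦ -((v - a * t) * Real.cos (ω * t) / ω) - a * Real.sin (ω * t) / ω ^ 2)
      ((v - a * t) * Real.sin (ω * t)) t := by
    have hlin : HasDerivAt (fun t ↦ ω * t) ω t := by simpa using (hasDerivAt_id t).const_mul ω
    have haff : HasDerivAt (fun t ↦ v - a * t) (-a) t := by
      simpa using ((hasDerivAt_id t).const_mul a).const_sub v
    refine (((haff.mul hlin.cos).div_const ω).neg.sub
      ((hlin.sin.const_mul a).div_const (ω ^ 2))).congr_deriv ?_
    field_simp
    ring
  rw [intervalIntegral.integral_eq_sub_of_hasDerivAt (fun t _ ↦ h t)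
    (Continuous.intervalIntegrable (by fun_prop) _ _)]
  simp only [mul_zero, Real.sin_zero, Real.cos_zero]
  ring

/-- Braking distance of the unicycle braking controller 2: with
`X, Y` the components of the displacement at the braking time `v/a`,
one has `X² + Y² = g(v, ω, a)/ω⁴` where
`g(v, ω, a) = v²ω² + 2a²(1 − cos(vω/a)) − 2vωa·sin(vω/a)`, and hence the
displacement `√(X² + Y²)` equals `√g/ω²`. -/
theorem unicycle_braking_distance
    (v a ω : ℝ) (hv : 0 < v) (ha : 0 < a) (hω : ω ≠ 0)
    (X Y g : ℝ)
    (hX : X = ∫ t in (0 : ℝ)..(v / a), (v - a * t) * Real.cos (ω * t))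
    (hY : Y = ∫ t in (0 : ℝ)..(v / a), (v - a * t) * Real.sin (ω * t))
    (hg : g = v ^ 2 * ω ^ 2 + 2 * a ^ 2 * (1 - Real.cos (v * ω / a))
      - 2 * v * ω * a * Real.sin (v * ω / a)) :
    X ^ 2 + Y ^ 2 = g / ω ^ 4 ∧
    Real.sqrt (X ^ 2 + Y ^ 2) = Real.sqrt g / ω ^ 2 := by
  have key : X ^ 2 + Y ^ 2 = g / ω ^ 4 := by
    have hT : v - a * (v / a) = 0 := by field_simp; ring
    have hθ : ω * (v / a) = v * ω / a := by ring
    rw [hX, hY, hg, integral_affine_mul_cos v a ω _ hω, integral_affine_mul_sin v a ω _ hω, hT, hθ]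
    have hsc := Real.sin_sq_add_cos_sq (v * ω / a)
    generalize Real.sin (v * ω / a) = s at *
    generalize Real.cos (v * ω / a) = c at *
    field_simp
    linear_combination a ^ 2 * hsc
  refine ⟨key, ?_⟩
  rw [key, Real.sqrt_div' _ (by positivity), show ω ^ 4 = (ω ^ 2) ^ 2 by ring,
    Real.sqrt_sq (sq_nonneg ω)]
end

section
/- Let E be a metric space and let p_i, p_j : ℝ → E be the position trajectories of two robots. Let Δ > 0 (the conflict-detection period), let L_i, L_j ≥ 0 (speed bounds) and D_i, D_j ≥ 0 (braking distances), and let R be a sensing radius with R > 2·max(D_i + Δ·L_i, D_j + Δ·L_j). Suppose that at a detection instant t₀ the robots satisfy dist(p_i(t₀), p_j(t₀)) ≥ R, that t₁ ∈ [t₀, t₀ + Δ], and that p_i and p_j are Lipschitz on [t₀, t₁] with constants L_i and L_j respectively. Then closedBall(p_i(t₁), D_i) ∩ closedBall(p_j(t₁), D_j) = ∅; in particular, if after time t₁ each robot k ∈ {i, j} executes an emergency stop during which its position remains in closedBall(p_k(t₁), D_k), the two robots' positions never coincide during the emergency stop. -/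
/-- Core quantitative safety lemma (Theorem 1, Emerg-mode case): if the sensing
radius satisfies `R > 2·max(Dᵢ + Δ·Lᵢ, Dⱼ + Δ·Lⱼ)`, the robots are at distance
at least `R` at detection time `t₀`, and their trajectories are Lipschitz with
constants `Lᵢ, Lⱼ` on `[t₀, t₁]` with `t₁ ∈ [t₀, t₀ + Δ]`, then the braking
balls at `t₁` are disjoint; hence emergency stops staying inside these balls
never lead to a collision. -/
theorem emergency_stop_safety
    {E : Type*} [MetricSpace E]
    (pi pj : ℝ → E) (Δ Li Lj Di Dj R t₀ t₁ : ℝ)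
    (hΔ : 0 < Δ) (hLi : 0 ≤ Li) (hLj : 0 ≤ Lj)
    (hDi : 0 ≤ Di) (hDj : 0 ≤ Dj)
    (hR : R > 2 * max (Di + Δ * Li) (Dj + Δ * Lj))
    (hdist : dist (pi t₀) (pj t₀) ≥ R)
    (ht₁ : t₁ ∈ Set.Icc t₀ (t₀ + Δ))
    (hlipi : ∀ s ∈ Set.Icc t₀ t₁, ∀ t ∈ Set.Icc t₀ t₁,
      dist (pi s) (pi t) ≤ Li * |s - t|)
    (hlipj : ∀ s ∈ Set.Icc t₀ t₁, ∀ t ∈ Set.Icc t₀ t₁,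
      dist (pj s) (pj t) ≤ Lj * |s - t|) :
    Metric.closedBall (pi t₁) Di ∩ Metric.closedBall (pj t₁) Dj = ∅ ∧
    (∀ qi qj : ℝ → E,
      (∀ t ≥ t₁, qi t ∈ Metric.closedBall (pi t₁) Di) →
      (∀ t ≥ t₁, qj t ∈ Metric.closedBall (pj t₁) Dj) →
      ∀ t ≥ t₁, qi t ≠ qj t) := by
  obtain ⟨h₀₁, h₁Δ⟩ := ht₁
  have travel : ∀ (p : ℝ → E) (L : ℝ), 0 ≤ L →
      (∀ s ∈ Set.Icc t₀ t₁, ∀ t ∈ Set.Icc t₀ t₁, dist (p s) (p t) ≤ L * |s - t|) →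
      dist (p t₀) (p t₁) ≤ Δ * L := by
    intro p L hL hp
    have h := hp t₀ (Set.left_mem_Icc.2 h₀₁) t₁ (Set.right_mem_Icc.2 h₀₁)
    have habs : |t₀ - t₁| ≤ Δ := abs_le.2 ⟨by linarith, by linarith⟩
    linarith [mul_le_mul_of_nonneg_left habs hL]
  have hi := travel pi Li hLi hlipi
  have hj := travel pj Lj hLj hlipj
  have hsep : Di + Dj < dist (pi t₁) (pj t₁) := by
    have htri := dist_triangle4 (pi t₀) (pi t₁) (pj t₁) (pj t₀)
    rw [dist_comm (pj t₁)] at htri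
    linarith [le_max_left (Di + Δ * Li) (Dj + Δ * Lj),
      le_max_right (Di + Δ * Li) (Dj + Δ * Lj)]
  have hdisj := Metric.closedBall_disjoint_closedBall hsep
  exact ⟨hdisj.inter_eq, fun _ _ hqi hqj t ht => hdisj.ne_of_mem (hqi t ht) (hqj t ht)⟩
end
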